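/- arXiv:2511.07942 — 2 statements merged into one kernel-verified Lean document; each statement's English description precedes it below -/
import Mathlib

section
/- Let S and A be finite nonempty sets, let π be a policy, let T and T⁰ be transition kernels, let γ ∈ (0,1) be a discount factor, and let μ be an initial distribution on S. If D_TV(T(·|s,a), T⁰(·|s,a)) ≤ ρ' for every pair (s,a) ∈ S × A, then the discounted state occupancy measures satisfy D_TV(d^π_T, d^π_{T⁰}) ≤ γρ'/(1−γ). -/
open Matrix

/-- Total variation distance between two (finitely supported) distributions:
`D_TV(p,q) = (1/2) ∑ₓ |p x − q x|`. -/
noncomputable def tvDist {X : Type*} [Fintype X] (p q : X → ℝ) : ℝ :=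
  (1 / 2) * ∑ x, |p x - q x|

/-- The state-transition matrix `P(s,s') = ∑ₐ π(a|s) T(s'|s,a)` induced by a
policy `π` and a transition kernel `T`. -/
noncomputable def policyMatrix {S A : Type*} [Fintype S] [Fintype A]
    (π : S → A → ℝ) (T : S → A → S → ℝ) : Matrix S S ℝ :=
  Matrix.of fun s s' => ∑ a, π s a * T s a s'

/-- The discounted state occupancy measure
`d^π_T(s) = (1−γ) ∑_{t≥0} γ^t (μᵀ Pᵗ)(s)`. -/
noncomputable def stateOcc {S A : Type*} [Fintype S] [DecidableEq S] [Fintype A]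
    (π : S → A → ℝ) (T : S → A → S → ℝ) (γ : ℝ) (μ : S → ℝ) (s : S) : ℝ :=
  (1 - γ) * ∑' t : ℕ, γ ^ t * Matrix.vecMul μ (policyMatrix π T ^ t) s

section StochasticMatrix

variable {S : Type*} [Fintype S]

/-- Right multiplication by a row-stochastic matrix preserves total mass. -/
theorem sum_vecMul_of_rowSum_eq_one {P : Matrix S S ℝ} (hP : ∀ s, ∑ s', P s s' = 1)
    (v : S → ℝ) : ∑ s, Matrix.vecMul v P s = ∑ s, v s := by
  simp only [Matrix.vecMul, dotProduct]
  rw [Finset.sum_comm]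
  simp [← Finset.mul_sum, hP]

/-- The `ℓ¹` norm of `v P` is at most `c` times the `ℓ¹` norm of `v` if the absolute row sums
of `P` are at most `c`. -/
theorem sum_abs_vecMul_le {P : Matrix S S ℝ} {c : ℝ} (hP : ∀ s, ∑ s', |P s s'| ≤ c)
    (v : S → ℝ) : ∑ s, |Matrix.vecMul v P s| ≤ c * ∑ s, |v s| := by
  calc ∑ s', |Matrix.vecMul v P s'| ≤ ∑ s', ∑ s, |v s| * |P s s'| := by
        refine Finset.sum_le_sum fun s' _ => ?_
        simp only [Matrix.vecMul, dotProduct, ← abs_mul]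
        exact Finset.abs_sum_le_sum_abs _ _
    _ = ∑ s, |v s| * ∑ s', |P s s'| := by
        rw [Finset.sum_comm]
        simp [Finset.mul_sum]
    _ ≤ ∑ s, |v s| * c := by
        gcongr with s
        exact hP s
    _ = c * ∑ s, |v s| := by rw [← Finset.sum_mul, mul_comm]

theorem vecMul_pow_nonneg [DecidableEq S] {P : Matrix S S ℝ} (hP : ∀ s s', 0 ≤ P s s')
    {v : S → ℝ} (hv : ∀ s, 0 ≤ v s) (t : ℕ) (s : S) : 0 ≤ Matrix.vecMul v (P ^ t) s := by
  induction t generalizing s with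
  | zero => simpa using hv s
  | succ t ih =>
    rw [pow_succ, ← Matrix.vecMul_vecMul]
    exact Finset.sum_nonneg fun i _ => mul_nonneg (ih i) (hP i s)

theorem sum_vecMul_pow [DecidableEq S] {P : Matrix S S ℝ} (hP : ∀ s, ∑ s', P s s' = 1)
    (v : S → ℝ) (t : ℕ) : ∑ s, Matrix.vecMul v (P ^ t) s = ∑ s, v s := by
  induction t with
  | zero => simp
  | succ t ih => rw [pow_succ, ← Matrix.vecMul_vecMul, sum_vecMul_of_rowSum_eq_one hP, ih]

theorem summable_discounted_vecMul_pow [DecidableEq S] {P : Matrix S S ℝ}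
    (hP : ∀ s s', 0 ≤ P s s') (hP1 : ∀ s, ∑ s', P s s' = 1) {v : S → ℝ} (hv : ∀ s, 0 ≤ v s)
    {γ : ℝ} (hγ0 : 0 ≤ γ) (hγ1 : γ < 1) (s : S) :
    Summable fun t : ℕ => γ ^ t * Matrix.vecMul v (P ^ t) s := by
  refine Summable.of_nonneg_of_le
    (fun t => mul_nonneg (pow_nonneg hγ0 t) (vecMul_pow_nonneg hP hv t s)) (fun t => ?_)
    ((summable_geometric_of_lt_one hγ0 hγ1).mul_right (∑ s, v s))
  rw [← sum_vecMul_pow hP1 v t]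
  exact mul_le_mul_of_nonneg_left
    (Finset.single_le_sum (fun i _ => vecMul_pow_nonneg hP hv t i) (Finset.mem_univ s))
    (pow_nonneg hγ0 t)

end StochasticMatrix

section Occupancy

variable {S A : Type*} [Fintype S] [Fintype A] {π : S → A → ℝ} {T : S → A → S → ℝ}

theorem policyMatrix_nonneg (hπ : ∀ s a, 0 ≤ π s a) (hT : ∀ s a s', 0 ≤ T s a s') (s s' : S) :
    0 ≤ policyMatrix π T s s' :=
  Finset.sum_nonneg fun a _ => mul_nonneg (hπ s a) (hT s a s')

theorem policyMatrix_sum (hπ : ∀ s, ∑ a, π s a = 1) (hT : ∀ s a, ∑ s', T s a s' = 1) (s : S) :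
    ∑ s', policyMatrix π T s s' = 1 := by
  simp only [policyMatrix, Matrix.of_apply]
  rw [Finset.sum_comm]
  simp [← Finset.mul_sum, hT, hπ]

theorem sum_abs_policyMatrix_sub_le {T0 : S → A → S → ℝ} (hπ : ∀ s a, 0 ≤ π s a)
    (hπ_sum : ∀ s, ∑ a, π s a = 1) {ρ : ℝ} (hρ : ∀ s a, tvDist (T s a) (T0 s a) ≤ ρ) (s : S) :
    ∑ s', |(policyMatrix π T - policyMatrix π T0) s s'| ≤ 2 * ρ := by
  calc ∑ s', |(policyMatrix π T - policyMatrix π T0) s s'|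
      ≤ ∑ s', ∑ a, π s a * |T s a s' - T0 s a s'| := by
        refine Finset.sum_le_sum fun s' _ => ?_
        simp only [policyMatrix, Matrix.sub_apply, Matrix.of_apply, ← Finset.sum_sub_distrib,
          ← mul_sub]
        refine (Finset.abs_sum_le_sum_abs _ _).trans_eq (Finset.sum_congr rfl fun a _ => ?_)
        rw [abs_mul, abs_of_nonneg (hπ s a)]
    _ = ∑ a, π s a * (2 * tvDist (T s a) (T0 s a)) := by
        rw [Finset.sum_comm]
        simp [tvDist, Finset.mul_sum]
    _ ≤ ∑ a, π s a * (2 * ρ) := by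
        gcongr with a
        · exact hπ s a
        · exact hρ s a
    _ = 2 * ρ := by rw [← Finset.sum_mul, hπ_sum, one_mul]

variable [DecidableEq S] {γ : ℝ} {μ : S → ℝ}

theorem stateOcc_nonneg (hπ : ∀ s a, 0 ≤ π s a) (hT : ∀ s a s', 0 ≤ T s a s')
    (hγ0 : 0 ≤ γ) (hγ1 : γ < 1) (hμ : ∀ s, 0 ≤ μ s) (s : S) : 0 ≤ stateOcc π T γ μ s :=
  mul_nonneg (sub_nonneg.2 hγ1.le) <| tsum_nonneg fun t =>
    mul_nonneg (pow_nonneg hγ0 t) (vecMul_pow_nonneg (policyMatrix_nonneg hπ hT) hμ t s)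

/-- The Bellman flow equation `d = (1 - γ) μ + γ d P`. -/
theorem stateOcc_eq_flow (hπ : ∀ s a, 0 ≤ π s a) (hπ_sum : ∀ s, ∑ a, π s a = 1)
    (hT : ∀ s a s', 0 ≤ T s a s') (hT_sum : ∀ s a, ∑ s', T s a s' = 1)
    (hγ0 : 0 ≤ γ) (hγ1 : γ < 1) (hμ : ∀ s, 0 ≤ μ s) :
    stateOcc π T γ μ =
      (1 - γ) • μ + γ • Matrix.vecMul (stateOcc π T γ μ) (policyMatrix π T) := by
  have hsum := summable_discounted_vecMul_pow (policyMatrix_nonneg hπ hT)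
    (policyMatrix_sum hπ_sum hT_sum) hμ hγ0 hγ1
  have hstep (s : S) : ∑' t : ℕ, γ ^ (t + 1) * Matrix.vecMul μ (policyMatrix π T ^ (t + 1)) s =
      γ * ∑ i, (∑' t : ℕ, γ ^ t * Matrix.vecMul μ (policyMatrix π T ^ t) i) *
        policyMatrix π T i s := by
    simp_rw [← tsum_mul_right]
    rw [← Summable.tsum_finsetSum fun i _ => (hsum i).mul_right _, ← tsum_mul_left]
    refine tsum_congr fun t => ?_
    rw [pow_succ (policyMatrix π T), ← Matrix.vecMul_vecMul, pow_succ' γ, mul_assoc]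
    congr 1
    rw [Matrix.vecMul, dotProduct, Finset.mul_sum]
    simp only [mul_assoc]
  funext s
  simp only [Pi.add_apply, Pi.smul_apply, smul_eq_mul]
  rw [stateOcc, (hsum s).tsum_eq_zero_add, hstep]
  simp only [Matrix.vecMul, dotProduct, stateOcc, mul_assoc, ← Finset.mul_sum, pow_zero,
    Matrix.one_apply, mul_ite, mul_one, mul_zero, Finset.sum_ite_eq', Finset.mem_univ, if_true,
    one_mul]
  ring

theorem stateOcc_sum (hπ : ∀ s a, 0 ≤ π s a) (hπ_sum : ∀ s, ∑ a, π s a = 1)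
    (hT : ∀ s a s', 0 ≤ T s a s') (hT_sum : ∀ s a, ∑ s', T s a s' = 1)
    (hγ0 : 0 ≤ γ) (hγ1 : γ < 1) (hμ : ∀ s, 0 ≤ μ s) (hμ_sum : ∑ s, μ s = 1) :
    ∑ s, stateOcc π T γ μ s = 1 := by
  have h : ∑ s, stateOcc π T γ μ s = (1 - γ) + γ * ∑ s, stateOcc π T γ μ s := by
    conv_lhs => rw [stateOcc_eq_flow hπ hπ_sum hT hT_sum hγ0 hγ1 hμ]
    simp only [Pi.add_apply, Pi.smul_apply, smul_eq_mul, Finset.sum_add_distrib,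
      ← Finset.mul_sum, hμ_sum, mul_one,
      sum_vecMul_of_rowSum_eq_one (policyMatrix_sum hπ_sum hT_sum)]
  have h' : (1 - γ) * (∑ s, stateOcc π T γ μ s - 1) = 0 := by linear_combination h
  rcases mul_eq_zero.1 h' with h0 | h0 <;> linarith

end Occupancy

theorem state_occupancy_tv_bound
    {S A : Type*} [Fintype S] [DecidableEq S] [Fintype A] [Nonempty S] [Nonempty A]
    (π : S → A → ℝ) (hπ_nonneg : ∀ s a, 0 ≤ π s a)
    (hπ_sum : ∀ s, ∑ a, π s a = 1)
    (T T0 : S → A → S → ℝ)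
    (hT_nonneg : ∀ s a s', 0 ≤ T s a s') (hT_sum : ∀ s a, ∑ s', T s a s' = 1)
    (hT0_nonneg : ∀ s a s', 0 ≤ T0 s a s') (hT0_sum : ∀ s a, ∑ s', T0 s a s' = 1)
    (γ : ℝ) (hγ0 : 0 < γ) (hγ1 : γ < 1)
    (μ : S → ℝ) (hμ_nonneg : ∀ s, 0 ≤ μ s) (hμ_sum : ∑ s, μ s = 1)
    (ρ' : ℝ) (hρ : ∀ s a, tvDist (T s a) (T0 s a) ≤ ρ') :
    tvDist (stateOcc π T γ μ) (stateOcc π T0 γ μ) ≤ γ * ρ' / (1 - γ) := by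
  set d := stateOcc π T γ μ with hd_def
  set d0 := stateOcc π T0 γ μ with hd0_def
  set P := policyMatrix π T with hP_def
  set P0 := policyMatrix π T0 with hP0_def
  have hd : d = (1 - γ) • μ + γ • Matrix.vecMul d P :=
    stateOcc_eq_flow hπ_nonneg hπ_sum hT_nonneg hT_sum hγ0.le hγ1 hμ_nonneg
  have hd0 : d0 = (1 - γ) • μ + γ • Matrix.vecMul d0 P0 :=
    stateOcc_eq_flow hπ_nonneg hπ_sum hT0_nonneg hT0_sum hγ0.le hγ1 hμ_nonneg
  have hd0_abs : ∑ s, |d0 s| = 1 := by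
    rw [← stateOcc_sum hπ_nonneg hπ_sum hT0_nonneg hT0_sum hγ0.le hγ1 hμ_nonneg hμ_sum]
    exact Finset.sum_congr rfl fun s _ =>
      abs_of_nonneg (stateOcc_nonneg hπ_nonneg hT0_nonneg hγ0.le hγ1 hμ_nonneg s)
  have hdiff (s : S) : d s - d0 s =
      γ * (Matrix.vecMul (d - d0) P s + Matrix.vecMul d0 (P - P0) s) := by
    have h := congrFun hd s
    have h0 := congrFun hd0 s
    simp only [Pi.add_apply, Pi.smul_apply, smul_eq_mul] at h h0
    rw [Matrix.sub_vecMul, Matrix.vecMul_sub, Pi.sub_apply, Pi.sub_apply]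
    linear_combination h - h0
  have hP_abs (s : S) : ∑ s', |P s s'| ≤ 1 := by
    rw [← policyMatrix_sum hπ_sum hT_sum s]
    exact (Finset.sum_congr rfl fun s' _ =>
      abs_of_nonneg (policyMatrix_nonneg hπ_nonneg hT_nonneg s s')).le
  have hflow := sum_abs_vecMul_le hP_abs (d - d0)
  have hpert := sum_abs_vecMul_le (sum_abs_policyMatrix_sub_le hπ_nonneg hπ_sum hρ) d0
  rw [hd0_abs] at hpert
  simp only [Pi.sub_apply] at hflow
  have hmain : ∑ s, |d s - d0 s| ≤ γ * (∑ s, |d s - d0 s| + 2 * ρ') := by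
    calc ∑ s, |d s - d0 s|
        ≤ ∑ s, γ * (|Matrix.vecMul (d - d0) P s| + |Matrix.vecMul d0 (P - P0) s|) := by
          refine Finset.sum_le_sum fun s _ => ?_
          rw [hdiff, abs_mul, abs_of_pos hγ0]
          exact mul_le_mul_of_nonneg_left (abs_add_le _ _) hγ0.le
      _ ≤ γ * (∑ s, |d s - d0 s| + 2 * ρ') := by
          rw [← Finset.mul_sum, Finset.sum_add_distrib]
          exact mul_le_mul_of_nonneg_left (by linarith) hγ0.le
  rw [tvDist, le_div_iff₀ (sub_pos.2 hγ1)]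
  linarith
end

section
/- Let f_SoftTV(x) = (1/2) log(cosh(x − 1)), let τ > 0, and let e ∈ ℝ with |e/τ| < 1/2. Set w* = max(0, artanh(2e/τ) + 1). Then for every w ≥ 0, −τ f_SoftTV(w) + e·w ≤ −τ f_SoftTV(w*) + e·w*; that is, w* maximizes w ↦ −τ f_SoftTV(w) + e·w over [0,∞). -/
/-- The soft total variation generator `f_SoftTV(x) = (1/2) log(cosh(x − 1))`. -/
noncomputable def fSoftTV (x : ℝ) : ℝ := (1 / 2) * Real.log (Real.cosh (x - 1))

/-- The inverse hyperbolic tangent `artanh(u) = (1/2) log((1+u)/(1−u))`,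
satisfying `tanh (artanh u) = u` for `|u| < 1`. -/
noncomputable def artanh (u : ℝ) : ℝ := (1 / 2) * Real.log ((1 + u) / (1 - u))

theorem artanh_eq_real_artanh {u : ℝ} (hu : u ∈ Set.Ioo (-1) 1) : artanh u = Real.artanh u := by
  rw [artanh, Real.artanh_eq_half_log (Set.Ioo_subset_Icc_self hu)]

theorem tanh_monotone : Monotone Real.tanh := by
  intro x y hxy
  contrapose! hxy
  simpa only [Real.artanh_tanh] using
    Real.artanh_lt_artanh (Real.neg_one_lt_tanh y) (Real.tanh_lt_one x) hxy

/-- The tangent line inequality for the log-convex function `cosh`. -/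
theorem cosh_mul_exp_tanh_mul_sub_le (x y : ℝ) :
    Real.cosh x * Real.exp (Real.tanh x * (y - x)) ≤ Real.cosh y := by
  have hc := Real.cosh_pos x
  have hsum : Real.exp x / (2 * Real.cosh x) + Real.exp (-x) / (2 * Real.cosh x) = 1 := by
    rw [← add_div, div_eq_one_iff_eq (by positivity), Real.cosh_eq]
    ring
  have htanh : Real.exp x / (2 * Real.cosh x) * (y - x) +
      Real.exp (-x) / (2 * Real.cosh x) * (-(y - x)) = Real.tanh x * (y - x) := by
    rw [Real.tanh_eq_sinh_div_cosh, Real.sinh_eq]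
    field_simp
    ring
  have h := convexOn_exp.2 (Set.mem_univ (y - x)) (Set.mem_univ (-(y - x)))
    (by positivity) (by positivity) hsum
  simp only [smul_eq_mul] at h
  rw [htanh] at h
  have e₁ : Real.exp x * Real.exp (y - x) = Real.exp y := by
    rw [← Real.exp_add]
    ring_nf
  have e₂ : Real.exp (-x) * Real.exp (-(y - x)) = Real.exp (-y) := by
    rw [← Real.exp_add]
    ring_nf
  calc Real.cosh x * Real.exp (Real.tanh x * (y - x))
      ≤ Real.cosh x * (Real.exp x / (2 * Real.cosh x) * Real.exp (y - x) +
          Real.exp (-x) / (2 * Real.cosh x) * Real.exp (-(y - x))) := by gcongr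
    _ = (Real.exp x * Real.exp (y - x) + Real.exp (-x) * Real.exp (-(y - x))) / 2 := by
        field_simp
    _ = Real.cosh y := by rw [e₁, e₂, Real.cosh_eq]

theorem fSoftTV_add_tanh_mul_sub_le (v w : ℝ) :
    fSoftTV v + 1 / 2 * Real.tanh (v - 1) * (w - v) ≤ fSoftTV w := by
  have h := Real.log_le_log (by positivity) (cosh_mul_exp_tanh_mul_sub_le (v - 1) (w - 1))
  rw [Real.log_mul (Real.cosh_pos _).ne' (Real.exp_pos _).ne', Real.log_exp,
    sub_sub_sub_cancel_right] at h
  unfold fSoftTV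
  linarith

theorem inner_max_softTV
    (τ : ℝ) (hτ : 0 < τ) (e : ℝ) (he : |e / τ| < 1 / 2) :
    ∀ w : ℝ, 0 ≤ w →
      -τ * fSoftTV w + e * w ≤
        -τ * fSoftTV (max 0 (artanh (2 * (e / τ)) + 1)) +
          e * max 0 (artanh (2 * (e / τ)) + 1) := by
  intro w hw
  have hu : 2 * (e / τ) ∈ Set.Ioo (-1 : ℝ) 1 := by
    obtain ⟨h₁, h₂⟩ := abs_lt.mp he
    constructor <;> linarith
  rw [artanh_eq_real_artanh hu]
  set a := Real.artanh (2 * (e / τ)) with ha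
  have hta : τ / 2 * Real.tanh a = e := by
    rw [ha, Real.tanh_artanh hu]
    field_simp
  set v := max 0 (a + 1) with hv
  have hslope : e * (w - v) ≤ τ / 2 * Real.tanh (v - 1) * (w - v) := by
    rcases le_total 0 (a + 1) with h | h
    · rw [hv, max_eq_right h, add_sub_cancel_right, hta]
    · rw [hv, max_eq_left h]
      have hmono : Real.tanh a ≤ Real.tanh (0 - 1) := tanh_monotone (by linarith)
      rw [← hta]
      have : 0 ≤ w - 0 := by linarith
      gcongr
  have htangent := mul_le_mul_of_nonneg_left (fSoftTV_add_tanh_mul_sub_le v w) hτ.le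
  linarith
end
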